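/- For every integer k ≥ 2 there exists a constant j_k > 0 such that for all x ≥ 0: ∫_0^1 du / ( (1 + x²(1−u)²)(1 + x²u²)(1−u)^{1−1/k} u^{1−1/k} ) ≤ j_k / (x² + 4). -/

import Mathlib

open MeasureTheory intervalIntegral

/-- On `[0, 1]` the larger of `u` and `1 - u` is at least `1 / 2`. -/
lemma one_add_sq_div_four_le_mul (x u : ℝ) (h0 : 0 ≤ u) (h1 : u ≤ 1) :
    (x ^ 2 + 4) / 4 ≤ (1 + x ^ 2 * (1 - u) ^ 2) * (1 + x ^ 2 * u ^ 2) := by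
  have hprod : 0 ≤ (x ^ 2 * (1 - u) ^ 2) * (x ^ 2 * u ^ 2) := by positivity
  rcases le_total u (1 / 2) with h | h
  · have hsq : (1 / 4 : ℝ) ≤ (1 - u) ^ 2 := by nlinarith
    nlinarith [mul_le_mul_of_nonneg_left hsq (sq_nonneg x), mul_nonneg (sq_nonneg x) (sq_nonneg u)]
  · have hsq : (1 / 4 : ℝ) ≤ u ^ 2 := by nlinarith
    nlinarith [mul_le_mul_of_nonneg_left hsq (sq_nonneg x),
      mul_nonneg (sq_nonneg x) (sq_nonneg (1 - u))]

lemma inv_rpow_mul_rpow_le {a u : ℝ} (ha : a ≤ 1) (h0 : 0 < u) (h1 : u < 1) :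
    ((1 - u) ^ a * u ^ a)⁻¹ ≤ (1 - u) ^ (-a) + u ^ (-a) := by
  have hv : 0 < 1 - u := by linarith
  have hp : u ≤ u ^ a := by
    simpa using Real.rpow_le_rpow_of_exponent_ge h0 h1.le ha
  have hq : 1 - u ≤ (1 - u) ^ a := by
    simpa using Real.rpow_le_rpow_of_exponent_ge hv (by linarith) ha
  have hp0 : 0 < u ^ a := by positivity
  have hq0 : 0 < (1 - u) ^ a := by positivity
  rw [Real.rpow_neg h0.le, Real.rpow_neg hv.le, inv_add_inv hq0.ne' hp0.ne', inv_eq_one_div]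
  gcongr
  linarith

lemma intervalIntegrable_one_sub_rpow_add_rpow {r : ℝ} (hr : -1 < r) :
    IntervalIntegrable (fun u : ℝ => (1 - u) ^ r + u ^ r) volume 0 1 := by
  have h : IntervalIntegrable (fun u : ℝ => u ^ r) volume 0 1 := intervalIntegrable_rpow' hr
  have h' : IntervalIntegrable (fun u : ℝ => (1 - u) ^ r) volume 0 1 := by
    simpa using (h.comp_sub_left 1).symm
  exact h'.add h

/-- The estimate (52): for every integer `k ≥ 2` there is `j_k > 0` such that for all
`x ≥ 0`, `∫_0^1 du/((1+x²(1−u)²)(1+x²u²)(1−u)^{1−1/k} u^{1−1/k}) ≤ j_k/(x²+4)`. -/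
theorem partial_fraction_integral_bound (k : ℕ) (hk : 2 ≤ k) :
    ∃ j : ℝ, 0 < j ∧ ∀ x : ℝ, 0 ≤ x →
      IntervalIntegrable
        (fun u : ℝ => ((1 + x ^ 2 * (1 - u) ^ 2) * (1 + x ^ 2 * u ^ 2) *
          (1 - u) ^ (1 - (k : ℝ)⁻¹) * u ^ (1 - (k : ℝ)⁻¹))⁻¹) volume 0 1 ∧
      (∫ u in (0:ℝ)..1, ((1 + x ^ 2 * (1 - u) ^ 2) * (1 + x ^ 2 * u ^ 2) *
          (1 - u) ^ (1 - (k : ℝ)⁻¹) * u ^ (1 - (k : ℝ)⁻¹))⁻¹) ≤ j / (x ^ 2 + 4) := by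
  set a : ℝ := 1 - (k : ℝ)⁻¹ with ha
  have hk0 : (0 : ℝ) < (k : ℝ)⁻¹ := by
    have : 0 < k := by omega
    positivity
  have hint := intervalIntegrable_one_sub_rpow_add_rpow (r := -a) (by linarith)
  have hnonneg : 0 ≤ ∫ u in (0:ℝ)..1, ((1 - u) ^ (-a) + u ^ (-a)) := by
    refine integral_nonneg zero_le_one fun u hu => ?_
    have := hu.1
    have : 0 ≤ 1 - u := sub_nonneg.2 hu.2
    positivity
  refine ⟨4 * (∫ u in (0:ℝ)..1, ((1 - u) ^ (-a) + u ^ (-a))) + 1, by positivity, fun x _ => ?_⟩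
  have hbound : ∀ u ∈ Set.Ioo (0 : ℝ) 1,
      ((1 + x ^ 2 * (1 - u) ^ 2) * (1 + x ^ 2 * u ^ 2) * (1 - u) ^ a * u ^ a)⁻¹ ≤
        4 / (x ^ 2 + 4) * ((1 - u) ^ (-a) + u ^ (-a)) := by
    intro u ⟨h0, h1⟩
    have hv : 0 < 1 - u := by linarith
    rw [mul_assoc _ ((1 - u) ^ a), mul_inv, ← inv_div (x ^ 2 + 4) 4]
    gcongr
    · exact one_add_sq_div_four_le_mul x u h0.le h1.le
    · exact inv_rpow_mul_rpow_le (by linarith) h0 h1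
  have hF : IntervalIntegrable (fun u : ℝ =>
      ((1 + x ^ 2 * (1 - u) ^ 2) * (1 + x ^ 2 * u ^ 2) * (1 - u) ^ a * u ^ a)⁻¹) volume 0 1 := by
    rw [intervalIntegrable_iff_integrableOn_Ioo_of_le zero_le_one]
    have hg := (hint.const_mul (4 / (x ^ 2 + 4)))
    rw [intervalIntegrable_iff_integrableOn_Ioo_of_le zero_le_one] at hg
    refine Integrable.mono' hg (Measurable.aestronglyMeasurable (by fun_prop)) ?_
    filter_upwards [ae_restrict_mem measurableSet_Ioo] with u hu
    have h0 := hu.1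
    have hv : 0 < 1 - u := sub_pos.2 hu.2
    rw [Real.norm_of_nonneg (by positivity)]
    exact hbound u hu
  refine ⟨hF, ?_⟩
  calc _ ≤ ∫ u in (0:ℝ)..1, 4 / (x ^ 2 + 4) * ((1 - u) ^ (-a) + u ^ (-a)) :=
        integral_mono_on_of_le_Ioo zero_le_one hF (hint.const_mul _) hbound
    _ = 4 * (∫ u in (0:ℝ)..1, ((1 - u) ^ (-a) + u ^ (-a))) / (x ^ 2 + 4) := by
        rw [intervalIntegral.integral_const_mul]
        ring
    _ ≤ _ := by
        gcongr
        linarith
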